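/- For every real γ with 0 < γ < 1: the series ∑_{ℓ=0}^{∞} g_ℓ^{(1−γ)} converges and its sum equals 0; moreover, for every integer k ≥ 1, −∑_{ℓ=1}^{k} g_ℓ^{(1−γ)} < (2−γ)/2 (equivalently, the partial sums satisfy ∑_{ℓ=0}^{k} g_ℓ^{(1−γ)} > 0). -/

import Mathlib

/-- Generalized binomial coefficient `C(μ,ℓ) = μ(μ−1)⋯(μ−ℓ+1)/ℓ!`. -/
noncomputable def genBinom (μ : ℝ) (ℓ : ℕ) : ℝ :=
  (∏ i ∈ Finset.range ℓ, (μ - i)) / (Nat.factorial ℓ : ℝ)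

/-- Grünwald–Letnikov coefficient `ϖ_ℓ^{(μ)} = (−1)^ℓ · C(μ,ℓ)`. -/
noncomputable def varpi (μ : ℝ) (ℓ : ℕ) : ℝ :=
  (-1 : ℝ) ^ ℓ * genBinom μ ℓ

/-- The coefficients `g_ℓ^{(1−γ)}`. -/
noncomputable def gcoef (γ : ℝ) : ℕ → ℝ
  | 0 => ((2 - γ) / 2) * varpi (1 - γ) 0
  | (ℓ + 1) => ((2 - γ) / 2) * varpi (1 - γ) (ℓ + 1) + (γ / 2) * varpi (1 - γ) ℓ

open Filter

/-- The partial sums `∑_{ℓ ≤ n} ϖ_ℓ^{(μ)}`, in product form. -/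
noncomputable def varpiPartialSum (μ : ℝ) (n : ℕ) : ℝ :=
  ∏ i ∈ Finset.range n, (1 - μ / ((i : ℝ) + 1))

lemma varpi_zero (μ : ℝ) : varpi μ 0 = 1 := by
  simp [varpi, genBinom]

lemma varpi_succ (μ : ℝ) (n : ℕ) :
    varpi μ (n + 1) = varpi μ n * ((n - μ) / ((n : ℝ) + 1)) := by
  have h : (Nat.factorial n : ℝ) ≠ 0 := by positivity
  have h' : (n : ℝ) + 1 ≠ 0 := by positivity
  simp only [varpi, genBinom, Finset.prod_range_succ, Nat.factorial_succ]
  push_cast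
  field_simp
  ring

lemma varpiPartialSum_succ (μ : ℝ) (n : ℕ) :
    varpiPartialSum μ (n + 1) = varpiPartialSum μ n * (1 - μ / ((n : ℝ) + 1)) :=
  Finset.prod_range_succ _ _

lemma varpi_succ_eq_mul_varpiPartialSum (μ : ℝ) (n : ℕ) :
    varpi μ (n + 1) = -(μ / ((n : ℝ) + 1)) * varpiPartialSum μ n := by
  induction n with
  | zero => simp [varpi_succ, varpi_zero, varpiPartialSum]
  | succ n ih =>
    have h : (n : ℝ) + 1 ≠ 0 := by positivity
    have h' : (n : ℝ) + 1 + 1 ≠ 0 := by positivity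
    rw [varpi_succ, ih, varpiPartialSum_succ]
    push_cast
    field_simp

lemma sum_range_varpi (μ : ℝ) (n : ℕ) :
    ∑ ℓ ∈ Finset.range (n + 1), varpi μ ℓ = varpiPartialSum μ n := by
  induction n with
  | zero => simp [varpi_zero, varpiPartialSum]
  | succ n ih =>
    rw [Finset.sum_range_succ, ih, varpi_succ_eq_mul_varpiPartialSum, varpiPartialSum_succ]
    ring

lemma varpiPartialSum_pos {μ : ℝ} (hμ : μ < 1) (n : ℕ) : 0 < varpiPartialSum μ n := by
  refine Finset.prod_pos fun i _ => ?_
  have h : (0 : ℝ) < (i : ℝ) + 1 := by positivity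
  rw [sub_pos, div_lt_one h]
  linarith [Nat.cast_nonneg (α := ℝ) i]

lemma tendsto_varpiPartialSum {μ : ℝ} (hμ0 : 0 < μ) (hμ1 : μ < 1) :
    Filter.Tendsto (varpiPartialSum μ) Filter.atTop (nhds 0) := by
  have hle (n : ℕ) : varpiPartialSum μ n ≤
      Real.exp (-(μ * ∑ i ∈ Finset.range n, 1 / ((i : ℝ) + 1))) := by
    rw [Finset.mul_sum, ← Finset.sum_neg_distrib, Real.exp_sum]
    refine Finset.prod_le_prod (fun i _ => ?_) fun i _ => ?_
    · have h : (0 : ℝ) < (i : ℝ) + 1 := by positivity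
      rw [sub_nonneg, div_le_one h]
      linarith [Nat.cast_nonneg (α := ℝ) i]
    · rw [mul_one_div]
      exact Real.one_sub_le_exp_neg _
  refine squeeze_zero (fun n => (varpiPartialSum_pos hμ1 n).le) hle ?_
  exact Real.tendsto_exp_neg_atTop_nhds_zero.comp
    (Real.tendsto_sum_range_one_div_nat_succ_atTop.const_mul_atTop hμ0)

lemma sum_range_gcoef (γ : ℝ) (n : ℕ) :
    ∑ ℓ ∈ Finset.range (n + 2), gcoef γ ℓ =
      (2 - γ) / 2 * varpiPartialSum (1 - γ) (n + 1) + γ / 2 * varpiPartialSum (1 - γ) n := by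
  rw [← sum_range_varpi, ← sum_range_varpi, Finset.sum_range_succ', Finset.sum_range_succ' (varpi _)]
  simp only [gcoef, Finset.sum_add_distrib, ← Finset.mul_sum]
  ring

/-- Lemma 5(ii): the series of `g_ℓ^{(1−γ)}` sums to 0 and the partial sums
satisfy the stated bound. -/
theorem stmt8 (γ : ℝ) (hγ0 : 0 < γ) (hγ1 : γ < 1) :
    Tendsto (fun n : ℕ => ∑ ℓ ∈ Finset.range n, gcoef γ ℓ) atTop (nhds 0) ∧
      ∀ k : ℕ, 1 ≤ k → -∑ ℓ ∈ Finset.Icc 1 k, gcoef γ ℓ < (2 - γ) / 2 := by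
  constructor
  · rw [← tendsto_add_atTop_iff_nat 2]
    simp only [sum_range_gcoef]
    have h := tendsto_varpiPartialSum (μ := 1 - γ) (by linarith) (by linarith)
    simpa using ((h.comp (tendsto_add_atTop_nat 1)).const_mul ((2 - γ) / 2)).add
      (h.const_mul (γ / 2))
  · intro k hk
    obtain ⟨n, rfl⟩ := Nat.exists_eq_add_of_le' hk
    have hpos : 0 < ∑ ℓ ∈ Finset.range (n + 2), gcoef γ ℓ := by
      have hP := varpiPartialSum_pos (μ := 1 - γ) (by linarith)
      rw [sum_range_gcoef]
      exact add_pos (mul_pos (by linarith) (hP _)) (mul_pos (by linarith) (hP _))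
    have hsplit : ∑ ℓ ∈ Finset.range (n + 2), gcoef γ ℓ =
        gcoef γ 0 + ∑ ℓ ∈ Finset.Icc 1 (n + 1), gcoef γ ℓ := by
      rw [Finset.range_eq_Ico, Finset.sum_eq_sum_Ico_succ_bot (by lia)]
      rfl
    have hzero : gcoef γ 0 = (2 - γ) / 2 := by simp [gcoef, varpi_zero]
    linarith
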